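/- For every n ≥ 1 and every x ∈ ℝ: −V'(x) = (β_n − x) R_{n,n}(x) + γ_n R_{n−1,n}(x) + γ_{n+1} R_{n+1,n}(x). -/

import Mathlib

open MeasureTheory Polynomial Real

/-- Subtracting the right multiple of the monic polynomial of the same degree lowers the degree. -/
theorem degree_sub_C_mul_lt {p : ℕ → ℝ[X]} (hmonic : ∀ n, (p n).Monic)
    (hpdeg : ∀ n, (p n).natDegree = n) {q : ℝ[X]} (hq : q ≠ 0) :
    (q - C q.leadingCoeff * p q.natDegree).degree < q.degree := by
  have hc : q.leadingCoeff ≠ 0 := leadingCoeff_ne_zero.mpr hq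
  refine degree_sub_lt_left ?_ hq ?_
  · rw [degree_C_mul hc, degree_eq_natDegree hq, degree_eq_natDegree (hmonic _).ne_zero, hpdeg]
  · simp [(hmonic _).leadingCoeff]

/-- A linear functional for which a monic family is orthogonal annihilates the product of a member
of the family with any polynomial of lower degree. -/
theorem map_mul_eq_zero_of_degree_lt (L : ℝ[X] →ₗ[ℝ] ℝ) {p : ℕ → ℝ[X]}
    (hmonic : ∀ n, (p n).Monic) (hpdeg : ∀ n, (p n).natDegree = n)
    (horth : ∀ n m, n ≠ m → L (p n * p m) = 0) (n : ℕ) (q : ℝ[X]) (hq : q.degree < n) :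
    L (p n * q) = 0 := by
  induction hd : q.degree using WellFoundedLT.induction generalizing q with
  | ind d ih =>
    subst hd
    by_cases hq0 : q = 0
    · simp [hq0]
    have hlt := degree_sub_C_mul_lt hmonic hpdeg hq0
    have h1 := ih _ hlt _ (hlt.trans hq) rfl
    have hne : n ≠ q.natDegree := by
      rw [degree_eq_natDegree hq0] at hq
      exact (Nat.cast_lt.mp hq).ne'
    have h2 : p n * q = p n * (q - C q.leadingCoeff * p q.natDegree)
        + q.leadingCoeff • (p n * p q.natDegree) := by
      rw [smul_eq_C_mul]; ring
    rw [h2, map_add, map_smul, h1, horth _ _ hne, smul_zero, add_zero]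

/-- A polynomial orthogonal to every member of the family up to its own degree vanishes. -/
theorem eq_zero_of_map_mul_eq_zero (L : ℝ[X] →ₗ[ℝ] ℝ) {p : ℕ → ℝ[X]}
    (hmonic : ∀ n, (p n).Monic) (hpdeg : ∀ n, (p n).natDegree = n)
    (horth : ∀ n m, n ≠ m → L (p n * p m) = 0) (hpos : ∀ n, 0 < L (p n * p n))
    {D : ℝ[X]} (hD : L (p D.natDegree * D) = 0) : D = 0 := by
  by_contra hD0
  have hlt := degree_sub_C_mul_lt hmonic hpdeg hD0
  rw [degree_eq_natDegree hD0] at hlt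
  have h1 := map_mul_eq_zero_of_degree_lt L hmonic hpdeg horth _ _ hlt
  have h2 : p D.natDegree * D = p D.natDegree * (D - C D.leadingCoeff * p D.natDegree)
      + D.leadingCoeff • (p D.natDegree * p D.natDegree) := by
    rw [smul_eq_C_mul]; ring
  rw [h2, map_add, map_smul, h1, zero_add, smul_eq_mul] at hD
  exact mul_ne_zero (leadingCoeff_ne_zero.mpr hD0) (hpos _).ne' hD

theorem degree_X_mul_sub_lt {p : ℕ → ℝ[X]} (hmonic : ∀ n, (p n).Monic)
    (hpdeg : ∀ n, (p n).natDegree = n) (n : ℕ) :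
    (X * p n - p (n + 1)).degree < ((n + 1 : ℕ) : WithBot ℕ) := by
  have hX : (X * p n).Monic := monic_X.mul (hmonic n)
  have hdeg : (X * p n).degree = ((n + 1 : ℕ) : WithBot ℕ) := by
    rw [degree_eq_natDegree hX.ne_zero, natDegree_X_mul (hmonic n).ne_zero, hpdeg]
  rw [← hdeg]
  refine degree_sub_lt_left ?_ hX.ne_zero ?_
  · rw [hdeg, degree_eq_natDegree (hmonic _).ne_zero, hpdeg]
  · rw [hX.leadingCoeff, (hmonic _).leadingCoeff]

/-- The three-term recurrence for monic orthogonal polynomials. -/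
theorem X_mul_eq_three_term (L : ℝ[X] →ₗ[ℝ] ℝ) {p : ℕ → ℝ[X]}
    (hmonic : ∀ n, (p n).Monic) (hpdeg : ∀ n, (p n).natDegree = n)
    (horth : ∀ n m, n ≠ m → L (p n * p m) = 0) (hpos : ∀ n, 0 < L (p n * p n)) (m : ℕ) :
    X * p (m + 1) = p (m + 2)
      + C (L (X * (p (m + 1) * p (m + 1))) / L (p (m + 1) * p (m + 1))) * p (m + 1)
      + C (L (p (m + 1) * p (m + 1)) / L (p m * p m)) * p m := by
  set b := L (X * (p (m + 1) * p (m + 1))) / L (p (m + 1) * p (m + 1)) with hb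
  set c := L (p (m + 1) * p (m + 1)) / L (p m * p m) with hc
  set D := X * p (m + 1) - p (m + 2) - C b * p (m + 1) - C c * p m with hDdef
  suffices hD : D = 0 by
    rw [hDdef] at hD
    linear_combination hD
  have hdeg : D.degree < (m + 2 : ℕ) := by
    have hp : ∀ (a : ℝ) (k : ℕ), k < m + 2 → (C a * p k).degree < (m + 2 : ℕ) := by
      intro a k hk
      refine lt_of_le_of_lt (degree_mul_le _ _) ?_
      refine lt_of_le_of_lt (add_le_add degree_C_le le_rfl) ?_
      rw [zero_add, degree_eq_natDegree (hmonic _).ne_zero, hpdeg]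
      exact_mod_cast hk
    refine lt_of_le_of_lt (degree_sub_le _ _) (max_lt ?_ (hp _ _ (by omega)))
    refine lt_of_le_of_lt (degree_sub_le _ _) (max_lt ?_ (hp _ _ (by omega)))
    exact degree_X_mul_sub_lt hmonic hpdeg (m + 1)
  by_contra hD0
  have hk : D.natDegree < m + 2 := by
    rw [degree_eq_natDegree hD0] at hdeg
    exact_mod_cast hdeg
  refine hD0 (eq_zero_of_map_mul_eq_zero L hmonic hpdeg horth hpos ?_)
  generalize D.natDegree = k at hk
  have hexp : L (p k * D) = L (p (m + 1) * (X * p k)) - L (p k * p (m + 2))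
      - b * L (p k * p (m + 1)) - c * L (p k * p m) := by
    have hpD : p k * D = p (m + 1) * (X * p k) - p k * p (m + 2)
        - b • (p k * p (m + 1)) - c • (p k * p m) := by
      simp only [smul_eq_C_mul, hDdef]
      ring
    rw [hpD]
    simp only [map_sub, map_smul, smul_eq_mul]
  rw [hexp, horth k (m + 2) (by omega)]
  rcases eq_or_ne k (m + 1) with rfl | h1
  · rw [horth (m + 1) m (by omega), hb, div_mul_cancel₀ _ (hpos _).ne', mul_left_comm]
    ring
  rw [horth k (m + 1) h1]
  rcases eq_or_ne k m with rfl | h2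
  · have h3 := map_mul_eq_zero_of_degree_lt L hmonic hpdeg horth _ _
      (degree_X_mul_sub_lt hmonic hpdeg k)
    rw [mul_sub, map_sub] at h3
    rw [hc, div_mul_cancel₀ _ (hpos _).ne']
    linarith
  · rw [horth k m h2, map_mul_eq_zero_of_degree_lt L hmonic hpdeg horth]
    · ring
    · rw [degree_eq_natDegree (monic_X.mul (hmonic k)).ne_zero,
        natDegree_X_mul (hmonic k).ne_zero, hpdeg]
      exact_mod_cast (by omega : k + 1 < m + 1)

/-- The functional `q ↦ ∫ q exp (-V)` on polynomials, when all these integrals converge. -/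
noncomputable def expWeightFunctional (V : ℝ[X])
    (hint : ∀ q : ℝ[X], Integrable (fun x : ℝ => q.eval x * Real.exp (-(V.eval x)))) :
    ℝ[X] →ₗ[ℝ] ℝ where
  toFun q := ∫ x : ℝ, q.eval x * Real.exp (-(V.eval x))
  map_add' q r := by
    simp only [eval_add, add_mul]
    exact integral_add (hint q) (hint r)
  map_smul' a q := by
    simp only [eval_smul, smul_eq_mul, mul_assoc, RingHom.id_apply]
    exact integral_const_mul _ _

/-- Integration by parts against `exp (-V)`. -/
theorem expWeightFunctional_derivative (V : ℝ[X])
    (hint : ∀ q : ℝ[X], Integrable (fun x : ℝ => q.eval x * Real.exp (-(V.eval x))))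
    (q : ℝ[X]) :
    expWeightFunctional V hint (derivative V * q)
      = expWeightFunctional V hint (derivative q) := by
  rw [eq_comm, ← sub_eq_zero, ← map_sub]
  refine integral_eq_zero_of_hasDerivAt_of_integrable (fun x => ?_) (hint _) (hint q)
  refine ((q.hasDerivAt x).mul (V.hasDerivAt x).neg.exp).congr_deriv ?_
  simp only [eval_sub, eval_mul, Pi.neg_apply]
  ring

theorem stmt7
    (V : Polynomial ℝ)
    (hVeven : Even V.natDegree) (hVdeg : 2 ≤ V.natDegree)
    (hVlead : 0 < V.leadingCoeff)
    (hint : ∀ q : Polynomial ℝ,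
      Integrable (fun x : ℝ => q.eval x * Real.exp (-(V.eval x))))
    (p : ℕ → Polynomial ℝ)
    (hmonic : ∀ n, (p n).Monic)
    (hpdeg : ∀ n, (p n).natDegree = n)
    (horth : ∀ n m, n ≠ m →
      ∫ x : ℝ, (p n).eval x * (p m).eval x * Real.exp (-(V.eval x)) = 0)
    (h : ℕ → ℝ)
    (hh : ∀ n, h n = ∫ x : ℝ, ((p n).eval x) ^ 2 * Real.exp (-(V.eval x)))
    (hhpos : ∀ n, 0 < h n)
    (ψ : ℕ → ℝ → ℝ)
    (hψ : ∀ n x, ψ n x = (p n).eval x * Real.exp (-(V.eval x) / 2) / Real.sqrt (h n))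
    (γ : ℕ → ℝ)
    (hγ : ∀ n, 1 ≤ n → γ n = Real.sqrt (h n / h (n - 1)))
    (β : ℕ → ℝ)
    (hβ : ∀ n, β n = ∫ x : ℝ, x * (ψ n x) ^ 2)
    (W : ℝ → Polynomial ℝ)
    (hW : ∀ x : ℝ, (X - C x) * W x = derivative V - C ((derivative V).eval x))
    (R : ℕ → ℕ → ℝ → ℝ)
    (hR : ∀ i j (x : ℝ), R i j x = ∫ t : ℝ, (W x).eval t * ψ i t * ψ j t)
    (n : ℕ) (hn : 1 ≤ n) (x : ℝ) :
    -(derivative V).eval x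
      = (β n - x) * R n n x + γ n * R (n - 1) n x + γ (n + 1) * R (n + 1) n x := by
  set L := expWeightFunctional V hint with hL
  have hLdef : ∀ q : ℝ[X], L q = ∫ x : ℝ, q.eval x * Real.exp (-(V.eval x)) := fun _ => rfl
  have horth' : ∀ n m, n ≠ m → L (p n * p m) = 0 := fun n m hnm => by
    simpa only [hLdef, eval_mul] using horth n m hnm
  have hh' : ∀ n, L (p n * p n) = h n := fun n => by
    simp only [hLdef, eval_mul, hh, sq]
  have hpos : ∀ n, 0 < L (p n * p n) := fun n => (hh' n).symm ▸ hhpos n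
  have hψψ : ∀ i j t, ψ i t * ψ j t
      = (√(h i) * √(h j))⁻¹ * ((p i * p j).eval t * Real.exp (-(V.eval t))) := by
    intro i j t
    have he : Real.exp (-(V.eval t)) = Real.exp (-(V.eval t) / 2) * Real.exp (-(V.eval t) / 2) := by
      rw [← Real.exp_add]
      ring_nf
    rw [hψ, hψ, he, eval_mul]
    field_simp
  have hQ : ∀ (q : ℝ[X]) i j, ∫ t : ℝ, q.eval t * ψ i t * ψ j t
      = (√(h i) * √(h j))⁻¹ * L (q * (p i * p j)) := by
    intro q i j
    rw [hLdef, ← integral_const_mul]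
    congr 1
    ext t
    rw [mul_assoc, hψψ, eval_mul (p := q)]
    ring
  have hs : ∀ i, √(h i) * √(h i) = h i := fun i => Real.mul_self_sqrt (hhpos i).le
  have hspos : ∀ i, 0 < √(h i) := fun i => Real.sqrt_pos.mpr (hhpos i)
  obtain ⟨m, rfl⟩ : ∃ m, n = m + 1 := ⟨n - 1, by omega⟩
  have hβ' : β (m + 1) = L (X * (p (m + 1) * p (m + 1))) / L (p (m + 1) * p (m + 1)) := by
    have := hQ X (m + 1) (m + 1)
    rw [hs] at this
    rw [hh', div_eq_inv_mul, ← this, hβ]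
    simp only [eval_X, sq, mul_assoc]
  have hrec := X_mul_eq_three_term L hmonic hpdeg horth' hpos m
  rw [← hβ', hh', hh'] at hrec
  have hR0 : R (m + 1) (m + 1) x = L (W x * (p (m + 1) * p (m + 1))) / h (m + 1) := by
    rw [hR, hQ, hs, div_eq_inv_mul]
  have hγ0 : γ (m + 1) * R m (m + 1) x = L (W x * (p m * p (m + 1))) / h m := by
    rw [hR, hQ, hγ _ hn, Nat.add_sub_cancel, Real.sqrt_div (hhpos _).le]
    have := hhpos m
    have := hspos m
    have := hspos (m + 1)
    field_simp
    rw [Real.sq_sqrt (hhpos _).le, mul_comm]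
  have hγ1 : γ (m + 1 + 1) * R (m + 1 + 1) (m + 1) x
      = L (W x * (p (m + 2) * p (m + 1))) / h (m + 1) := by
    rw [hR, hQ, hγ _ (by omega), Nat.add_sub_cancel, Real.sqrt_div (hhpos _).le]
    have := hhpos (m + 1)
    have := hspos (m + 1)
    have := hspos (m + 1 + 1)
    field_simp
    rw [Real.sq_sqrt (hhpos _).le, mul_comm]
  have hV : L (derivative V * (p (m + 1) * p (m + 1))) = 0 := by
    have hdp : (derivative (p (m + 1))).degree < (m + 1 : ℕ) := by
      have := degree_derivative_lt (hmonic (m + 1)).ne_zero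
      rwa [degree_eq_natDegree (hmonic (m + 1)).ne_zero, hpdeg] at this
    have h0 := map_mul_eq_zero_of_degree_lt L hmonic hpdeg horth' _ _ hdp
    rw [hL, expWeightFunctional_derivative, ← hL, derivative_mul, map_add, h0, mul_comm, h0,
      add_zero]
  have hkey : L (derivative V * (p (m + 1) * p (m + 1)))
        - (derivative V).eval x * L (p (m + 1) * p (m + 1))
      = L (W x * (p (m + 2) * p (m + 1))) + (β (m + 1) - x) * L (W x * (p (m + 1) * p (m + 1)))
        + h (m + 1) / h m * L (W x * (p m * p (m + 1))) := by
    have hpoly : derivative V * (p (m + 1) * p (m + 1))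
          - (derivative V).eval x • (p (m + 1) * p (m + 1))
        = W x * (p (m + 2) * p (m + 1)) + (β (m + 1) - x) • (W x * (p (m + 1) * p (m + 1)))
          + (h (m + 1) / h m) • (W x * (p m * p (m + 1))) := by
      simp only [smul_eq_C_mul, C_sub]
      linear_combination (-(p (m + 1) * p (m + 1))) * hW x + W x * p (m + 1) * hrec
    simpa only [map_sub, map_add, map_smul, smul_eq_mul] using congrArg L hpoly
  rw [hV, hh'] at hkey
  rw [Nat.add_sub_cancel, hγ0, hγ1, hR0]
  have h1 := (hhpos (m + 1)).ne'
  have h2 := (hhpos m).ne'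
  field_simp at hkey ⊢
  linear_combination hkey
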